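/- arXiv:1208.0946 — 2 statements merged into one kernel-verified Lean document; each statement's English description precedes it below -/
import Mathlib

section
/- Let g : Finset V → ℝ be monotone nondecreasing and submodular. Define the greedy sequence S_0 = ∅ and S_i = S_{i−1} ∪ {s_i}, where at each step s_i is an element of V maximizing g(S_{i−1} ∪ {v}) over v ∈ V. Let k be the smallest index with g(S_k) ≥ g(V), and let k* = min{|T| : T ⊆ V, g(T) ≥ g(V)}. If g(S_{k−1}) < g(V) and k* ≥ 1, then k / k* ≤ 1 + log( (g(V) − g(∅)) / (g(V) − g(S_{k−1})) ). -/
open Finset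

/-- A set function `g` on subsets of `V` is submodular if for all `S ⊆ T` and `v ∉ T`,
`g(S ∪ {v}) − g(S) ≥ g(T ∪ {v}) − g(T)`. -/
def FinsetSubmodular {V : Type*} [DecidableEq V] (g : Finset V → ℝ) : Prop :=
  ∀ S T : Finset V, S ⊆ T → ∀ v : V, v ∉ T →
    g (insert v S) - g S ≥ g (insert v T) - g T

/-- A set function `g` is monotone nondecreasing if `S ⊆ T` implies `g(S) ≤ g(T)`. -/
def FinsetNondecreasing {V : Type*} (g : Finset V → ℝ) : Prop :=
  ∀ S T : Finset V, S ⊆ T → g S ≤ g T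

/-- Adding a set `T` to `S` gains at most `#T` times a bound on the marginal gains at `S`. -/
theorem FinsetSubmodular.union_sub_le {V : Type*} [DecidableEq V] {g : Finset V → ℝ}
    (hsub : FinsetSubmodular g) {S : Finset V} {d : ℝ} (hd : 0 ≤ d)
    (hS : ∀ v, g (insert v S) - g S ≤ d) (T : Finset V) :
    g (S ∪ T) - g S ≤ #T * d := by
  induction T using Finset.induction_on with
  | empty => simp
  | insert v T hv ih =>
    rw [union_insert, card_insert_of_notMem hv]
    push_cast
    by_cases hvS : v ∈ S ∪ T
    · rw [insert_eq_of_mem hvS]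
      linarith
    · linarith [hsub S (S ∪ T) subset_union_left v hvS, hS v]

/-- A sequence decreasing by at least a fraction `1 / n` of its value at each step decays
exponentially. -/
theorem le_exp_neg_div_mul_of_le_mul_sub {a : ℕ → ℝ} {n : ℝ} (hn : 0 < n)
    (ha : ∀ i, 0 ≤ a i) (hstep : ∀ i, a i ≤ n * (a i - a (i + 1))) (j : ℕ) :
    a j ≤ Real.exp (-(j / n)) * a 0 := by
  induction j with
  | zero => simp
  | succ j ih =>
    have hdrop : a j / n ≤ a j - a (j + 1) := (div_le_iff₀' hn).2 (hstep j)
    calc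
      a (j + 1) ≤ (-(1 / n) + 1) * a j := by
        have : (-(1 / n) + 1) * a j = a j - a j / n := by ring
        linarith
      _ ≤ Real.exp (-(1 / n)) * a j :=
        mul_le_mul_of_nonneg_right (Real.add_one_le_exp _) (ha j)
      _ ≤ Real.exp (-(1 / n)) * (Real.exp (-(j / n)) * a 0) := by gcongr
      _ = Real.exp (-((j + 1 : ℕ) / n)) * a 0 := by
        rw [← mul_assoc, ← Real.exp_add]
        congr 2
        push_cast
        ring

/-- Greedy guarantee for minimum-size submodular cover: if `g` is monotone nondecreasing and
submodular, `S_i` is the greedy sequence, `k` is the smallest index with `g(S_k) ≥ g(V)`,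
`k* = min{|T| : g(T) ≥ g(V)}`, `g(S_{k−1}) < g(V)` and `k* ≥ 1`, then
`k / k* ≤ 1 + log((g(V) − g(∅)) / (g(V) − g(S_{k−1})))`. -/
theorem greedy_submodular_cover_bound {V : Type*} [DecidableEq V] [Fintype V] [Nonempty V]
    (g : Finset V → ℝ) (hmono : FinsetNondecreasing g) (hsub : FinsetSubmodular g)
    (S : ℕ → Finset V) (s : ℕ → V)
    (hS0 : S 0 = ∅)
    (hstep : ∀ i : ℕ, 1 ≤ i →
      S i = insert (s i) (S (i - 1)) ∧
        ∀ v : V, g (insert v (S (i - 1))) ≤ g (insert (s i) (S (i - 1))))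
    (k : ℕ)
    (hk_cover : g Finset.univ ≤ g (S k))
    (hk_min : ∀ j : ℕ, g Finset.univ ≤ g (S j) → k ≤ j)
    (kstar : ℕ) (hkstar_pos : 1 ≤ kstar)
    (hkstar_exists : ∃ T : Finset V, T.card = kstar ∧ g Finset.univ ≤ g T)
    (hkstar_min : ∀ T : Finset V, g Finset.univ ≤ g T → kstar ≤ T.card)
    (hlast : g (S (k - 1)) < g Finset.univ) :
    (k : ℝ) / (kstar : ℝ) ≤
      1 + Real.log ((g Finset.univ - g ∅) / (g Finset.univ - g (S (k - 1)))) := by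
  obtain ⟨T, rfl, hT⟩ := hkstar_exists
  obtain ⟨m, rfl⟩ : ∃ m, k = m + 1 := by
    refine Nat.exists_eq_succ_of_ne_zero ?_
    rintro rfl
    exact hlast.not_ge hk_cover
  rw [Nat.add_sub_cancel] at hlast ⊢
  have hn : (1 : ℝ) ≤ #T := by exact_mod_cast hkstar_pos
  have hn0 : (0 : ℝ) < #T := by linarith
  have hgap : ∀ i, g univ - g (S i) ≤
      #T * ((g univ - g (S i)) - (g univ - g (S (i + 1)))) := by
    intro i
    obtain ⟨hS, hmax⟩ := hstep (i + 1) (Nat.le_add_left 1 i)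
    rw [Nat.add_sub_cancel] at hS hmax
    rw [← hS] at hmax
    have hgain : 0 ≤ g (S (i + 1)) - g (S i) :=
      sub_nonneg.2 (hmono _ _ (hS ▸ subset_insert _ _))
    have hunion := hsub.union_sub_le hgain (fun v => sub_le_sub_right (hmax v) _) T
    have hTS := hmono T (S i ∪ T) subset_union_right
    rw [sub_sub_sub_cancel_left]
    linarith
  have hdecay := le_exp_neg_div_mul_of_le_mul_sub hn0
    (fun i => sub_nonneg.2 (hmono _ _ (subset_univ (S i)))) hgap m
  rw [hS0, Real.exp_neg, inv_mul_eq_div, le_div_iff₀' (Real.exp_pos _)] at hdecay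
  have hpos : 0 < g univ - g (S m) := sub_pos.2 hlast
  have hratio : Real.exp (m / #T) ≤ (g univ - g ∅) / (g univ - g (S m)) :=
    (le_div_iff₀ hpos).2 hdecay
  have hlog : (m / #T : ℝ) ≤ Real.log ((g univ - g ∅) / (g univ - g (S m))) :=
    (Real.le_log_iff_exp_le ((Real.exp_pos _).trans_le hratio)).2 hratio
  have hone : (1 / #T : ℝ) ≤ 1 := (div_le_one hn0).2 hn
  push_cast
  rw [add_div]
  linarith
end

section
/- Let L₁, …, L_M be weighted Laplacians of connected graphs on the common finite vertex set V, and let π₁, …, π_M ≥ 0 be nonnegative weights. Then the expected system error S ↦ Σ_{i=1}^{M} π_i · R(S | L_i), defined on nonempty subsets S ⊆ V, is a supermodular function of S: for all nonempty S ⊆ T ⊊ V and v ∈ V \ T, Σ_i π_i R(S|L_i) − Σ_i π_i R(S∪{v}|L_i) ≥ Σ_i π_i R(T|L_i) − Σ_i π_i R(T∪{v}|L_i). -/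
open Matrix Finset

/-- The grounded Laplacian: the principal submatrix of `L` obtained by deleting the rows and
columns indexed by the set `S`. -/
noncomputable def grounded {V : Type*} [Fintype V] [DecidableEq V]
    (L : Matrix V V ℝ) (S : Finset V) : Matrix {x : V // x ∉ S} {x : V // x ∉ S} ℝ :=
  L.submatrix (fun i => (i : V)) (fun j => (j : V))

/-- The system error `R(S | L) = (1/2) · trace((L_S)⁻¹)` (equal to `0` when `S = V`). -/
noncomputable def sysError {V : Type*} [Fintype V] [DecidableEq V]
    (L : Matrix V V ℝ) (S : Finset V) : ℝ :=
  (1 / 2 : ℝ) * Matrix.trace (grounded L S)⁻¹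

/-- A sum over the complement of `S` equals the full sum if the summand vanishes on `S`. -/
lemma sum_compl_subtype_eq_sum {V : Type*} [Fintype V] [DecidableEq V] {S : Finset V} {f : V → ℝ}
    (hf : ∀ x ∈ S, f x = 0) : ∑ x : {x : V // x ∉ S}, f x = ∑ x, f x := by
  rw [← Fintype.sum_subtype_add_sum_subtype (fun x => x ∉ S) f, left_eq_add]
  exact Finset.sum_eq_zero fun x _ => hf x (not_not.mp x.2)

/-- The comparison principle: if `u` is nonnegative on `S` and `L u` is nonnegative off `S`, then
`u` is nonnegative everywhere. -/
lemma nonneg_of_mulVec_nonneg {V : Type*} [Fintype V] [DecidableEq V] {L : Matrix V V ℝ}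
    (hoff : ∀ a b : V, a ≠ b → L a b ≤ 0) {S : Finset V} (hpd : (grounded L S).PosDef)
    {u : V → ℝ} (huS : ∀ x ∈ S, 0 ≤ u x) (hu : ∀ x ∉ S, 0 ≤ (L *ᵥ u) x) (x : V) : 0 ≤ u x := by
  set w : {x : V // x ∉ S} → ℝ := fun x => max (-u x) 0 with hw
  have key : ∀ x : {x : V // x ∉ S}, w x * (grounded L S *ᵥ w) x ≤ 0 := by
    intro x
    rcases le_or_gt 0 (u x) with hx | hx
    · simp [hw, hx]
    refine mul_nonpos_of_nonneg_of_nonpos (le_max_right _ _) ?_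
    have h1 : (grounded L S *ᵥ w) x = ∑ y, L x y * max (-u y) 0 :=
      sum_compl_subtype_eq_sum (f := fun y => L x y * max (-u y) 0) fun y hy => by simp [huS y hy]
    have h2 : ∑ y, L x y * max (-u y) 0 ≤ ∑ y, L x y * -u y := by
      refine Finset.sum_le_sum fun y _ => ?_
      by_cases hxy : (x : V) = y
      · rw [← hxy, max_eq_left (by linarith)]
      · exact mul_le_mul_of_nonpos_left (le_max_left _ _) (hoff _ _ hxy)
    have h3 : ∑ y, L x y * -u y = -(L *ᵥ u) x := by
      simp [Matrix.mulVec, dotProduct]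
    linarith [hu x x.2]
  have hw0 : w = 0 := by
    by_contra hne
    have hpos := hpd.dotProduct_mulVec_pos hne
    have : star w ⬝ᵥ (grounded L S *ᵥ w) ≤ 0 := by
      simpa [dotProduct] using Finset.sum_nonpos fun x _ => key x
    linarith
  by_cases hx : x ∈ S
  · exact huS x hx
  · have := congrFun hw0 ⟨x, hx⟩
    simpa [hw] using this

/-- A function vanishing on `S` and harmonic off `S` is zero. -/
lemma eq_zero_of_mulVec_eq_zero {V : Type*} [Fintype V] [DecidableEq V] {L : Matrix V V ℝ}
    (hoff : ∀ a b : V, a ≠ b → L a b ≤ 0) {S : Finset V} (hpd : (grounded L S).PosDef)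
    {u : V → ℝ} (huS : ∀ x ∈ S, u x = 0) (hu : ∀ x ∉ S, (L *ᵥ u) x = 0) (x : V) : u x = 0 := by
  refine le_antisymm ?_ (nonneg_of_mulVec_nonneg hoff hpd (fun x hx => (huS x hx).ge)
    (fun x hx => (hu x hx).ge) x)
  have := nonneg_of_mulVec_nonneg hoff hpd (u := -u) (fun x hx => by simp [huS x hx])
    (fun x hx => by simp [Matrix.mulVec_neg, hu x hx]) x
  simpa using this

/-- The Green function of `L` grounded at `S`: the inverse of the grounded Laplacian, extended by
zero. -/
noncomputable def green {V : Type*} [Fintype V] [DecidableEq V]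
    (L : Matrix V V ℝ) (S : Finset V) (x y : V) : ℝ :=
  if h : x ∉ S ∧ y ∉ S then (grounded L S)⁻¹ ⟨x, h.1⟩ ⟨y, h.2⟩ else 0

section Green

variable {V : Type*} [Fintype V] [DecidableEq V] {L : Matrix V V ℝ} {S T : Finset V}

lemma green_of_left_mem {x : V} (hx : x ∈ S) (y : V) : green L S x y = 0 := by
  simp [green, hx]

lemma green_of_right_mem (x : V) {y : V} (hy : y ∈ S) : green L S x y = 0 := by
  simp [green, hy]

lemma green_comm (hL : L.IsSymm) (x y : V) : green L S x y = green L S y x := by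
  have hG : ((grounded L S)⁻¹)ᵀ = (grounded L S)⁻¹ := by
    rw [Matrix.transpose_nonsing_inv]
    congr 1
    exact hL.submatrix _
  by_cases h : x ∉ S ∧ y ∉ S
  · rw [green, green, dif_pos h, dif_pos h.symm, ← Matrix.transpose_apply (grounded L S)⁻¹, hG]
  · rw [green, green, dif_neg h, dif_neg fun h' => h h'.symm]

lemma sysError_eq_sum_green : sysError L S = 1 / 2 * ∑ x, green L S x x := by
  rw [sysError, ← sum_compl_subtype_eq_sum (S := S) fun x hx => green_of_left_mem hx x]
  congr 1
  refine Finset.sum_congr rfl fun x _ => ?_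
  simp [green, x.2]

lemma green_self_pos (hpd : (grounded L S).PosDef) {v : V} (hv : v ∉ S) : 0 < green L S v v := by
  rw [green, dif_pos ⟨hv, hv⟩]
  exact hpd.inv.diag_pos

lemma mulVec_green (hpd : (grounded L S).PosDef) {x y : V} (hx : x ∉ S) (hy : y ∉ S) :
    (L *ᵥ fun z => green L S z y) x = if x = y then 1 else 0 := by
  have h : (grounded L S * (grounded L S)⁻¹) ⟨x, hx⟩ ⟨y, hy⟩ = if x = y then 1 else 0 := by
    rw [Matrix.mul_nonsing_inv _ ((Matrix.isUnit_iff_isUnit_det _).mp hpd.isUnit)]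
    simp [Matrix.one_apply]
  rw [← h, Matrix.mulVec, dotProduct, Matrix.mul_apply,
    ← sum_compl_subtype_eq_sum (S := S) fun z hz => by rw [green_of_left_mem hz, mul_zero]]
  refine Finset.sum_congr rfl fun z _ => ?_
  simp [green, z.2, hy, grounded]

lemma green_nonneg (hoff : ∀ a b : V, a ≠ b → L a b ≤ 0) (hpd : (grounded L S).PosDef)
    (x y : V) : 0 ≤ green L S x y := by
  by_cases hy : y ∈ S
  · rw [green_of_right_mem x hy]
  · refine nonneg_of_mulVec_nonneg hoff hpd (u := fun z => green L S z y)
      (fun z hz => (green_of_left_mem hz y).ge) (fun z hz => ?_) x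
    rw [mulVec_green hpd hz hy]
    split_ifs <;> simp

/-- The Green function decreases as the grounded set grows. -/
lemma green_anti (hoff : ∀ a b : V, a ≠ b → L a b ≤ 0) (hS : (grounded L S).PosDef)
    (hT : (grounded L T).PosDef) (hST : S ⊆ T) {v : V} (hv : v ∉ T) (x : V) :
    green L T x v ≤ green L S x v := by
  rw [← sub_nonneg]
  refine nonneg_of_mulVec_nonneg hoff hT
    (u := (fun z => green L S z v) - fun z => green L T z v) (fun z hz => ?_) (fun z hz => ?_) x
  · simpa [green_of_left_mem hz] using green_nonneg hoff hS z v
  · rw [Matrix.mulVec_sub, Pi.sub_apply, mulVec_green hS (fun h => hz (hST h)) (fun h => hv (hST h)),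
      mulVec_green hT hz hv, sub_self]

/-- The probability of hitting `v` before the grounded set decreases as that set grows. -/
lemma green_div_self_anti (hoff : ∀ a b : V, a ≠ b → L a b ≤ 0) (hS : (grounded L S).PosDef)
    (hT : (grounded L T).PosDef) {v : V} (hTv : (grounded L (insert v T)).PosDef) (hST : S ⊆ T)
    (hv : v ∉ T) (x : V) :
    (green L T v v)⁻¹ * green L T x v ≤ (green L S v v)⁻¹ * green L S x v := by
  have hvS : v ∉ S := fun h => hv (hST h)
  have hSv := green_self_pos hS hvS
  have hTv' := green_self_pos hT hv
  rw [← sub_nonneg]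
  refine nonneg_of_mulVec_nonneg hoff hTv
    (u := (green L S v v)⁻¹ • (fun z => green L S z v) -
      (green L T v v)⁻¹ • fun z => green L T z v) (fun z hz => ?_) (fun z hz => ?_) x
  · rcases Finset.mem_insert.mp hz with rfl | hz
    · simp [hSv.ne', hTv'.ne']
    · simpa [green_of_left_mem hz] using
        mul_nonneg (inv_nonneg.mpr hSv.le) (green_nonneg hoff hS z v)
  · rw [Finset.mem_insert, not_or] at hz
    simp [Matrix.mulVec_sub, Matrix.mulVec_smul, mulVec_green hS (fun h => hz.2 (hST h)) hvS,
      mulVec_green hT hz.2 hv, hz.1]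

/-- The effect on the Green function of grounding one more vertex. -/
lemma green_insert (hoff : ∀ a b : V, a ≠ b → L a b ≤ 0) (hS : (grounded L S).PosDef) {v : V}
    (hSv : (grounded L (insert v S)).PosDef) (hv : v ∉ S) (x y : V) :
    green L (insert v S) x y =
      green L S x y - (green L S v v)⁻¹ * green L S v y * green L S x v := by
  have hpos := green_self_pos hS hv
  by_cases hy : y ∈ insert v S
  · rw [green_of_right_mem x hy]
    rcases Finset.mem_insert.mp hy with rfl | hy
    · simp [hpos.ne']
    · simp [green_of_right_mem _ hy]
  rw [eq_comm, ← sub_eq_zero]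
  refine eq_zero_of_mulVec_eq_zero hoff hSv
    (u := (fun z => green L S z y) - ((green L S v v)⁻¹ * green L S v y) • (fun z => green L S z v)
      - fun z => green L (insert v S) z y) (fun z hz => ?_) (fun z hz => ?_) x
  · have h0 : green L (insert v S) z y = 0 := green_of_left_mem hz y
    rcases Finset.mem_insert.mp hz with rfl | hz
    · simp only [Pi.sub_apply, Pi.smul_apply, smul_eq_mul, h0]
      field_simp
      ring
    · simp [h0, green_of_left_mem hz]
  · have hins := mulVec_green hSv hz hy
    rw [Finset.mem_insert, not_or] at hz hy
    simp [Matrix.mulVec_sub, Matrix.mulVec_smul, mulVec_green hS hz.2 hy.2,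
      mulVec_green hS hz.2 hv, hins, hz.1]

lemma sysError_sub_insert (hL : L.IsSymm) (hoff : ∀ a b : V, a ≠ b → L a b ≤ 0)
    (hS : (grounded L S).PosDef) {v : V} (hSv : (grounded L (insert v S)).PosDef) (hv : v ∉ S) :
    sysError L S - sysError L (insert v S) =
      1 / 2 * ∑ x, (green L S v v)⁻¹ * green L S x v * green L S x v := by
  rw [sysError_eq_sum_green, sysError_eq_sum_green, ← mul_sub, ← Finset.sum_sub_distrib]
  congr 1
  refine Finset.sum_congr rfl fun x _ => ?_
  rw [green_insert hoff hS hSv hv, green_comm hL v x, sub_sub_cancel]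

/-- The system error of a single Laplacian is supermodular. -/
lemma sysError_supermodular (hL : L.IsSymm) (hoff : ∀ a b : V, a ≠ b → L a b ≤ 0)
    (hpd : ∀ S : Finset V, S.Nonempty → (grounded L S).PosDef) (hS : S.Nonempty) (hST : S ⊆ T)
    {v : V} (hv : v ∉ T) :
    sysError L T - sysError L (insert v T) ≤ sysError L S - sysError L (insert v S) := by
  have hpS := hpd S hS
  have hpT := hpd T (hS.mono hST)
  have hpTv := hpd _ (Finset.insert_nonempty v T)
  have hvS : v ∉ S := fun h => hv (hST h)
  rw [sysError_sub_insert hL hoff hpS (hpd _ (Finset.insert_nonempty v S)) hvS,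
    sysError_sub_insert hL hoff hpT hpTv hv]
  gcongr 1 / 2 * ∑ x, ?_ with x
  exact mul_le_mul (green_div_self_anti hoff hpS hpT hpTv hST hv x)
    (green_anti hoff hpS hpT hST hv x) (green_nonneg hoff hpT x v)
    (mul_nonneg (inv_nonneg.mpr (green_nonneg hoff hpS v v)) (green_nonneg hoff hpS x v))

end Green

/-- The expected system error `S ↦ Σ_i π_i · R(S | L_i)` over weighted Laplacians `L_1, …, L_M`
with nonnegative weights `π_i` is supermodular: for all nonempty `S ⊆ T ⊊ V` and `v ∈ V \ T`,
`Σ_i π_i R(S|L_i) − Σ_i π_i R(S∪{v}|L_i) ≥ Σ_i π_i R(T|L_i) − Σ_i π_i R(T∪{v}|L_i)`. -/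
theorem expected_sysError_supermodular {V : Type*} [Fintype V] [DecidableEq V] [Nonempty V]
    (M : ℕ) (L : Fin M → Matrix V V ℝ) (π : Fin M → ℝ)
    (hπ : ∀ i : Fin M, 0 ≤ π i)
    (hsymm : ∀ i : Fin M, (L i).IsSymm)
    (hoffdiag : ∀ i : Fin M, ∀ a b : V, a ≠ b → L i a b ≤ 0)
    (hrowsum : ∀ i : Fin M, ∀ a : V, ∑ b : V, L i a b = 0)
    (hpd : ∀ i : Fin M, ∀ S : Finset V, S.Nonempty → (grounded (L i) S).PosDef)
    (S T : Finset V) (hS : S.Nonempty) (hST : S ⊆ T) (hT : T ⊂ Finset.univ)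
    (v : V) (hv : v ∉ T) :
    ∑ i : Fin M, π i * sysError (L i) S - ∑ i : Fin M, π i * sysError (L i) (insert v S) ≥
      ∑ i : Fin M, π i * sysError (L i) T -
        ∑ i : Fin M, π i * sysError (L i) (insert v T) := by
  rw [ge_iff_le, ← Finset.sum_sub_distrib, ← Finset.sum_sub_distrib]
  refine Finset.sum_le_sum fun i _ => ?_
  rw [← mul_sub, ← mul_sub]
  exact mul_le_mul_of_nonneg_left
    (sysError_supermodular (hsymm i) (hoffdiag i) (hpd i) hS hST hv) (hπ i)
end
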